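/- Let 1 ≤ k ≤ n. For every degree d ≥ 0, dim_ℚ (S_{n,k})_d = Σ_{j=k}^{n} dim_ℚ (R_{n,j})_{d−(n−j)}, where homogeneous components in negative degree are zero; equivalently, Hilb(S_{n,k}; q) = Σ_{j=k}^{n} q^{n−j} · Hilb(R_{n,j}; q). -/

import Mathlib

open scoped BigOperators

namespace PackedWords

/-- An ordered set partition of `[n] = {1, …, n}` with `k` blocks: a sequence
`B_1 | ⋯ | B_k` of nonempty pairwise disjoint subsets of `[n]` whose union is `[n]`. -/
structure OSP (n k : ℕ) where
  blocks : Fin k → Finset ℕ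
  subset_range : ∀ j, blocks j ⊆ Finset.Icc 1 n
  blocks_nonempty : ∀ j, (blocks j).Nonempty
  blocks_disjoint : ∀ j₁ j₂ : Fin k, j₁ ≠ j₂ → Disjoint (blocks j₁) (blocks j₂)
  cover : ∀ i ∈ Finset.Icc 1 n, ∃ j, i ∈ blocks j

/-- Common generalization of the coinversion code (`b = 0`) and the boosted
coinversion code (`b = 1`).  Position `p : Fin n` corresponds to the letter
`i = p + 1` of `[n]`.  If `i ∈ B_j` (blocks indexed `0, …, k-1`, so `j` here is
the paper's `j - 1`), then `c_i = #{ℓ > j : min B_ℓ > i}` if `i = min B_j`, and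
`c_i = #{ℓ > j : min B_ℓ > i} + (j - 1) + b` (in the paper's 1-indexing) otherwise. -/
noncomputable def codeAux {n k : ℕ} (b : ℕ) (σ : OSP n k) (p : Fin n) : ℕ :=
  if h : ∃ j, ((p : ℕ) + 1) ∈ σ.blocks j then
    (Finset.univ.filter fun ℓ : Fin k =>
        h.choose < ℓ ∧ ∀ x ∈ σ.blocks ℓ, (p : ℕ) + 1 < x).card
      + (if ∀ x ∈ σ.blocks h.choose, (p : ℕ) + 1 ≤ x then 0 else (h.choose : ℕ) + b)
  else 0

/-- The coinversion code of an ordered set partition. -/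
noncomputable def code {n k : ℕ} (σ : OSP n k) : Fin n → ℕ := codeAux 0 σ

/-- The boosted coinversion code of an ordered set partition. -/
noncomputable def bcode {n k : ℕ} (σ : OSP n k) : Fin n → ℕ := codeAux 1 σ

/-- The skip sequence of a finite set `S = {s_1 < s_2 < ⋯} ⊆ ℕ`:
`γ_i = i - j + 1` if `i = s_j ∈ S`, and `γ_i = 0` otherwise. -/
def skip (S : Finset ℕ) (i : ℕ) : ℕ :=
  if i ∈ S then i - (S.filter (· < i)).card else 0

/-- The reverse skip sequence `γ(S)* = (γ_n, …, γ_1)` of `S ⊆ [n]`, read at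
position `p : Fin n` (so position `p` carries `γ_{n - p}` in 1-indexed terms). -/
def revSkipAt (n : ℕ) (S : Finset ℕ) (p : Fin n) : ℕ := skip S (n - (p : ℕ))

/-- For `T ⊆ [n-1]` with skip sequence `γ = γ(T)`, the length-`n` sequence
`(γ_{n-1}, …, γ_i, d, γ_{i-1}, …, γ_1)` obtained from the reverse skip sequence of `T`
by inserting `d` in position `n - i + 1` (1-indexed), read at position `p : Fin n`. -/
def insSeq (n i d : ℕ) (T : Finset ℕ) (p : Fin n) : ℕ :=
  if (p : ℕ) + 1 ≤ n - i then skip T (n - ((p : ℕ) + 1))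
  else if (p : ℕ) + 1 = n - i + 1 then d
  else skip T (n - ((p : ℕ) + 1) + 1)

/-- `Packedk n k w`: `w` is a packed word of length `n` on the alphabet of positive
integers (whenever `i + 1` appears as a letter, so does `i`) in which each of the
letters `1, 2, …, k` appears. -/
def Packedk (n k : ℕ) (w : Fin n → ℕ) : Prop :=
  (∀ p, 1 ≤ w p) ∧ (∀ i, 1 ≤ i → (∃ p, w p = i + 1) → ∃ p, w p = i) ∧
    (∀ j, 1 ≤ j → j ≤ k → ∃ p, w p = j)

/-- The elementary symmetric polynomial of degree `a` in the variables `X j`, `j ∈ s`. -/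
noncomputable def esymmOn (n : ℕ) (s : Finset (Fin n)) (a : ℕ) : MvPolynomial (Fin n) ℚ :=
  ∑ t ∈ s.powersetCard a, ∏ j ∈ t, MvPolynomial.X j

/-- The complete homogeneous symmetric polynomial of degree `b` evaluated at
`α 1, α 2, …, α d`. -/
noncomputable def hval (b d : ℕ) (α : ℕ → ℚ) : ℚ :=
  ∑ m : Sym (Fin d) b, ((m : Multiset (Fin d)).map fun j => α ((j : ℕ) + 1)).prod

/-- The locus `X_{n,k} ⊆ ℚ^n` of points `(α_{w_1}, …, α_{w_n})` for `w ∈ W_{n,k}`. -/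
def packedPoints (n k : ℕ) (α : ℕ → ℚ) : Set (Fin n → ℚ) :=
  {x | ∃ w : Fin n → ℕ, Packedk n k w ∧ x = fun p => α (w p)}

/-- The ideal `J_n = ⟨x_i^d e_{n-r}^{(i)} : 1 ≤ i ≤ n, 1 ≤ r ≤ d⟩`. -/
noncomputable def Jn (n : ℕ) : Ideal (MvPolynomial (Fin n) ℚ) :=
  Ideal.span {g | ∃ (i : Fin n) (r d : ℕ), 1 ≤ r ∧ r ≤ d ∧
    g = MvPolynomial.X i ^ d * esymmOn n {i}ᶜ (n - r)}

/-- The ideal `J_{n,k} = J_n + ⟨e_n, e_{n-1}, …, e_{n-k+1}⟩`. -/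
noncomputable def Jnk (n k : ℕ) : Ideal (MvPolynomial (Fin n) ℚ) :=
  Jn n ⊔ Ideal.span {g | ∃ j : ℕ, n - k + 1 ≤ j ∧ j ≤ n ∧ g = esymmOn n Finset.univ j}

/-- The Haglund–Rhoades–Shimozono ideal
`I_{n,k} = ⟨x_1^k, …, x_n^k, e_n, e_{n-1}, …, e_{n-k+1}⟩`. -/
noncomputable def Ink (n k : ℕ) : Ideal (MvPolynomial (Fin n) ℚ) :=
  Ideal.span ({g | ∃ i : Fin n, g = MvPolynomial.X i ^ k} ∪
    {g | ∃ j : ℕ, n - k + 1 ≤ j ∧ j ≤ n ∧ g = esymmOn n Finset.univ j})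

/-- `T(X)`: the ideal generated by the top-degree homogeneous components `τ(f)` of
all nonzero polynomials `f` vanishing on `X`. -/
noncomputable def gradedIdeal (n : ℕ) (X : Set (Fin n → ℚ)) : Ideal (MvPolynomial (Fin n) ℚ) :=
  Ideal.span {g | ∃ f : MvPolynomial (Fin n) ℚ, f ≠ 0 ∧
    (∀ x ∈ X, MvPolynomial.eval x f = 0) ∧
    g = MvPolynomial.homogeneousComponent f.totalDegree f}

/-- The degree-`d` homogeneous component of the quotient `ℚ[x_1, …, x_n]/I`,
namely the image of the space of homogeneous polynomials of degree `d`. -/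
noncomputable def quotComp (n : ℕ) (I : Ideal (MvPolynomial (Fin n) ℚ)) (d : ℕ) :
    Submodule ℚ (MvPolynomial (Fin n) ℚ ⧸ I) :=
  Submodule.map (Ideal.Quotient.mkₐ ℚ I).toLinearMap
    (MvPolynomial.homogeneousSubmodule (Fin n) ℚ d)

/-- The degree-`(d - a)` homogeneous component of `ℚ[x_1, …, x_n]/I`, interpreted as
zero when `d - a < 0` (degree shift by `a`). -/
noncomputable def quotCompShift (n : ℕ) (I : Ideal (MvPolynomial (Fin n) ℚ)) (d a : ℕ) :
    Submodule ℚ (MvPolynomial (Fin n) ℚ ⧸ I) :=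
  if a ≤ d then quotComp n I (d - a) else ⊥

lemma packedk_comp {n k : ℕ} {w : Fin n → ℕ} (σ : Equiv.Perm (Fin n)) (h : Packedk n k w) :
    Packedk n k (w ∘ σ) := by
  obtain ⟨h1, h2, h3⟩ := h
  refine ⟨fun p => h1 _, fun i hi hex => ?_, fun j hj hjk => ?_⟩
  · obtain ⟨q, hq⟩ := h2 i hi (by obtain ⟨p, hp⟩ := hex; exact ⟨σ p, hp⟩)
    exact ⟨σ.symm q, by simpa using hq⟩
  · obtain ⟨q, hq⟩ := h3 j hj hjk
    exact ⟨σ.symm q, by simpa using hq⟩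

/-- The left action of a permutation `σ ∈ S_n` on packed words, sending `w` to
`w ∘ σ⁻¹` (the permutation action on positions). -/
noncomputable def wordPerm (n k : ℕ) (σ : Equiv.Perm (Fin n)) :
    {w : Fin n → ℕ // Packedk n k w} ≃ {w : Fin n → ℕ // Packedk n k w} where
  toFun w := ⟨w.1 ∘ σ.symm, packedk_comp σ.symm w.2⟩
  invFun w := ⟨w.1 ∘ σ, packedk_comp σ w.2⟩
  left_inv w := Subtype.ext (funext fun p => by simp)
  right_inv w := Subtype.ext (funext fun p => by simp)

open MvPolynomial

theorem homogeneousComponent_mul_of_isHomogeneous {n : ℕ} (p : MvPolynomial (Fin n) ℚ)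
    {e : MvPolynomial (Fin n) ℚ} {c : ℕ} (he : e.IsHomogeneous c) (d : ℕ) :
    homogeneousComponent d (p * e) =
      if c ≤ d then homogeneousComponent (d - c) p * e else 0 := by
  induction p using MvPolynomial.induction_on' with
  | add p q hp hq =>
    rw [add_mul, map_add, hp, hq, map_add]
    split_ifs <;> ring
  | monomial u a =>
    have hm : (monomial u a : MvPolynomial (Fin n) ℚ).IsHomogeneous u.degree :=
      isHomogeneous_monomial a rfl
    rw [homogeneousComponent_of_mem (hm.mul he), homogeneousComponent_of_mem hm]
    split_ifs <;> first | rfl | omega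

/-- An additive property of elements of an ideal span only needs to be checked on multiples of
generators. -/
theorem ideal_span_induction {R : Type*} [CommRing R] {G : Set R} {P : R → Prop}
    (zero : P 0) (add : ∀ x y, P x → P y → P (x + y)) (mul : ∀ a, ∀ g ∈ G, P (a * g))
    {f : R} (hf : f ∈ Ideal.span G) : P f := by
  obtain ⟨m, a, g, rfl⟩ := Submodule.mem_span_set'.1 hf
  exact Finset.sum_induction _ P add zero fun i _ => mul _ _ (g i).2

theorem homogeneousComponent_mem_span {n : ℕ} {G : Set (MvPolynomial (Fin n) ℚ)}
    (hG : ∀ g ∈ G, ∃ c, g.IsHomogeneous c) {f : MvPolynomial (Fin n) ℚ}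
    (hf : f ∈ Ideal.span G) (d : ℕ) : homogeneousComponent d f ∈ Ideal.span G := by
  refine ideal_span_induction (P := fun f => homogeneousComponent d f ∈ Ideal.span G)
    ?_ ?_ ?_ hf
  · simp
  · intro x y hx hy
    rw [map_add]
    exact add_mem hx hy
  · intro a g hg
    obtain ⟨c, hc⟩ := hG g hg
    rw [homogeneousComponent_mul_of_isHomogeneous a hc]
    split_ifs
    · exact Ideal.mul_mem_left _ _ (Ideal.subset_span hg)
    · exact zero_mem _

theorem mem_quotComp {n : ℕ} {I : Ideal (MvPolynomial (Fin n) ℚ)} {d : ℕ}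
    {x : MvPolynomial (Fin n) ℚ ⧸ I} :
    x ∈ quotComp n I d ↔
      ∃ p : MvPolynomial (Fin n) ℚ, p.IsHomogeneous d ∧ Ideal.Quotient.mk I p = x :=
  Iff.rfl

instance finite_quotComp (n : ℕ) (I : Ideal (MvPolynomial (Fin n) ℚ)) (d : ℕ) :
    Module.Finite ℚ (quotComp n I d) :=
  Module.Finite.iff_fg.2 ((homogeneousSubmodule_fg (Fin n) ℚ d).map _)

/-- If the monomials with exponents in `B` span the quotient by a homogeneous ideal, then the
total dimension of the graded pieces is at most the cardinality of `B`. -/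
theorem sum_finrank_quotComp_le_card {n : ℕ} {I : Ideal (MvPolynomial (Fin n) ℚ)}
    (hI : ∀ f ∈ I, ∀ d, homogeneousComponent d f ∈ I) (B : Finset (Fin n →₀ ℕ))
    (hB : ∀ p : MvPolynomial (Fin n) ℚ, ∃ q ∈ Submodule.span ℚ
      ((fun m => (monomial m (1 : ℚ) : MvPolynomial (Fin n) ℚ)) '' (B : Set (Fin n →₀ ℕ))),
        p - q ∈ I) (D : ℕ) :
    ∑ d ∈ Finset.range D, Module.finrank ℚ (quotComp n I d) ≤ B.card := by
  classical
  have key : ∀ d, Module.finrank ℚ (quotComp n I d) ≤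
      (B.filter fun m => m.degree = d).card := by
    intro d
    let S : Finset (MvPolynomial (Fin n) ℚ ⧸ I) :=
      (B.filter fun m => m.degree = d).image
        fun m => Ideal.Quotient.mk I (monomial m (1 : ℚ))
    have hle : quotComp n I d ≤ Submodule.span ℚ (S : Set (MvPolynomial (Fin n) ℚ ⧸ I)) := by
      intro x hx
      obtain ⟨p, hp, rfl⟩ := mem_quotComp.1 hx
      obtain ⟨q, hq, hpq⟩ := hB p
      have h1 := hI _ hpq d
      rw [map_sub, homogeneousComponent_eq_self hp, ← Ideal.Quotient.eq] at h1
      rw [h1]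
      clear h1 hpq
      induction hq using Submodule.span_induction with
      | mem y hy =>
        obtain ⟨m, hm, rfl⟩ := hy
        simp only
        have hm' : (monomial m (1 : ℚ) : MvPolynomial (Fin n) ℚ).IsHomogeneous m.degree :=
          isHomogeneous_monomial 1 rfl
        rw [homogeneousComponent_of_mem hm']
        split_ifs with h
        · refine Submodule.subset_span ?_
          simp only [S, Finset.coe_image]
          exact ⟨m, by simpa using ⟨hm, h.symm⟩, rfl⟩
        · simp
      | zero => simp
      | add y z _ _ hy hz =>
        rw [map_add, map_add]
        exact add_mem hy hz
      | smul a y _ hy =>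
        rw [map_smul]
        exact Submodule.smul_mem _ a hy
    calc Module.finrank ℚ (quotComp n I d)
        ≤ Module.finrank ℚ (Submodule.span ℚ (S : Set (MvPolynomial (Fin n) ℚ ⧸ I))) :=
          Submodule.finrank_mono hle
      _ ≤ S.card := finrank_span_finset_le_card S
      _ ≤ _ := Finset.card_image_le
  calc ∑ d ∈ Finset.range D, Module.finrank ℚ (quotComp n I d)
      ≤ ∑ d ∈ Finset.range D, (B.filter fun m => m.degree = d).card :=
        Finset.sum_le_sum fun d _ => key d
    _ = ((Finset.range D).biUnion fun d => B.filter fun m => m.degree = d).card := by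
        rw [Finset.card_biUnion]
        intro a _ b _ hab
        refine Finset.disjoint_left.2 fun m h1 h2 => hab ?_
        rw [← (Finset.mem_filter.1 h1).2, (Finset.mem_filter.1 h2).2]
    _ ≤ B.card := Finset.card_le_card (Finset.biUnion_subset.2 fun d _ => Finset.filter_subset _ _)

/-- Dimension bound coming from the right exact sequence `R/I → R/J → R/(J + ⟨e⟩) → 0` whose first
map is multiplication by `e`. -/
theorem finrank_quotComp_le_add {n c : ℕ} {I J : Ideal (MvPolynomial (Fin n) ℚ)}
    {e : MvPolynomial (Fin n) ℚ} (he : e.IsHomogeneous c)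
    (hJ : ∀ f ∈ J, ∀ d, homogeneousComponent d f ∈ J) (hIJ : ∀ f ∈ I, f * e ∈ J) (d : ℕ) :
    Module.finrank ℚ (quotComp n J d) ≤
      Module.finrank ℚ (quotComp n (J ⊔ Ideal.span {e}) d) +
        Module.finrank ℚ (quotCompShift n I d c) := by
  let π : (MvPolynomial (Fin n) ℚ ⧸ J) →ₗ[ℚ] (MvPolynomial (Fin n) ℚ ⧸ (J ⊔ Ideal.span {e})) :=
    (Ideal.Quotient.factorₐ ℚ (le_sup_left : J ≤ J ⊔ Ideal.span {e})).toLinearMap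
  let μ : (MvPolynomial (Fin n) ℚ ⧸ I) →ₗ[ℚ] (MvPolynomial (Fin n) ℚ ⧸ J) :=
    (Submodule.mapQ I J (LinearMap.mulRight (MvPolynomial (Fin n) ℚ) e) hIJ).restrictScalars ℚ
  let φ := π.comp (quotComp n J d).subtype
  have hker : Submodule.map (quotComp n J d).subtype (LinearMap.ker φ) ≤
      Submodule.map μ (quotCompShift n I d c) := by
    rintro _ ⟨⟨x, hx⟩, hx0, rfl⟩
    obtain ⟨p, hp, rfl⟩ := mem_quotComp.1 hx
    have hp0 : p ∈ J ⊔ Ideal.span {e} := Ideal.Quotient.eq_zero_iff_mem.1 hx0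
    obtain ⟨g, hg, t, ht, rfl⟩ := Submodule.mem_sup.1 hp0
    obtain ⟨h, rfl⟩ := Ideal.mem_span_singleton'.1 ht
    have h1 := homogeneousComponent_eq_self hp
    rw [map_add, homogeneousComponent_mul_of_isHomogeneous h he] at h1
    simp only [Submodule.subtype_apply]
    rw [← h1, map_add, Ideal.Quotient.eq_zero_iff_mem.2 (hJ g hg d), zero_add]
    unfold quotCompShift
    split_ifs
    · exact ⟨Ideal.Quotient.mk I (homogeneousComponent (d - c) h),
        ⟨_, homogeneousComponent_mem _ _, rfl⟩, rfl⟩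
    · simp
  have hrange : LinearMap.range φ ≤ quotComp n (J ⊔ Ideal.span {e}) d := by
    rintro _ ⟨⟨x, hx⟩, rfl⟩
    obtain ⟨p, hp, rfl⟩ := mem_quotComp.1 hx
    exact ⟨p, hp, rfl⟩
  have : Module.Finite ℚ (quotCompShift n I d c) := by
    by_cases h : c ≤ d
    · rw [show quotCompShift n I d c = quotComp n I (d - c) from if_pos h]
      infer_instance
    · rw [show quotCompShift n I d c = ⊥ from if_neg h]
      infer_instance
  rw [← LinearMap.finrank_range_add_finrank_ker φ]
  refine add_le_add (Submodule.finrank_mono hrange) ?_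
  rw [← Submodule.finrank_map_subtype_eq]
  exact (Submodule.finrank_mono hker).trans (Submodule.finrank_map_le _ _)

theorem esymmOn_zero (n : ℕ) (T : Finset (Fin n)) : esymmOn n T 0 = 1 := by
  simp [esymmOn]

theorem esymmOn_eq_zero {n : ℕ} {T : Finset (Fin n)} {m : ℕ} (h : T.card < m) :
    esymmOn n T m = 0 := by
  rw [esymmOn, Finset.powersetCard_eq_empty.2 h, Finset.sum_empty]

theorem esymmOn_insert {n : ℕ} {T : Finset (Fin n)} {a : Fin n} (ha : a ∉ T) (m : ℕ) :
    esymmOn n (insert a T) (m + 1) = esymmOn n T (m + 1) + X a * esymmOn n T m := by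
  have hmem : ∀ t ∈ T.powersetCard m, a ∉ t := fun t ht h =>
    ha ((Finset.mem_powersetCard.1 ht).1 h)
  unfold esymmOn
  rw [Finset.powersetCard_succ_insert ha, Finset.sum_union, Finset.sum_image, Finset.mul_sum]
  · congr 1
    exact Finset.sum_congr rfl fun t ht => Finset.prod_insert (hmem t ht)
  · intro t ht u hu htu
    rw [← Finset.erase_insert (hmem t ht), ← Finset.erase_insert (hmem u hu)]
    exact congrArg (fun v => Finset.erase v a) htu
  · refine Finset.disjoint_left.2 fun t ht hu => ?_
    obtain ⟨u, -, rfl⟩ := Finset.mem_image.1 hu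
    exact ha ((Finset.mem_powersetCard.1 ht).1 (Finset.mem_insert_self a u))

theorem isHomogeneous_esymmOn (n : ℕ) (T : Finset (Fin n)) (m : ℕ) :
    (esymmOn n T m).IsHomogeneous m := by
  refine IsHomogeneous.sum _ _ _ fun t ht => ?_
  have h := IsHomogeneous.prod t (fun j => (X j : MvPolynomial (Fin n) ℚ)) (fun _ => 1)
    fun j _ => isHomogeneous_X ℚ j
  rwa [Finset.sum_const, (Finset.mem_powersetCard.1 ht).2, smul_eq_mul, mul_one] at h

/-- The ideal of `ℚ[x_1, …, x_n]` whose quotient is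
`ℚ[x_i : i ∈ T] / ⟨x_i ^ k, e_{|T|}, …, e_{|T| - s + 1}⟩`. -/
noncomputable def subsetIdeal {n : ℕ} (T : Finset (Fin n)) (k s : ℕ) :
    Ideal (MvPolynomial (Fin n) ℚ) :=
  Ideal.span ({g | ∃ i, i ∉ T ∧ g = X i} ∪ ({g | ∃ i ∈ T, g = X i ^ k} ∪
    {g | ∃ m, T.card < m + s ∧ g = esymmOn n T m}))

theorem X_mem_subsetIdeal {n : ℕ} {T : Finset (Fin n)} {k s : ℕ} {i : Fin n} (hi : i ∉ T) :
    X i ∈ subsetIdeal T k s :=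
  Ideal.subset_span (Or.inl ⟨i, hi, rfl⟩)

theorem X_pow_mem_subsetIdeal {n : ℕ} {T : Finset (Fin n)} {k s : ℕ} {i : Fin n} (hi : i ∈ T) :
    X i ^ k ∈ subsetIdeal T k s :=
  Ideal.subset_span (Or.inr (Or.inl ⟨i, hi, rfl⟩))

theorem esymmOn_mem_subsetIdeal {n : ℕ} {T : Finset (Fin n)} {k s m : ℕ} (h : T.card < m + s) :
    esymmOn n T m ∈ subsetIdeal T k s :=
  Ideal.subset_span (Or.inr (Or.inr ⟨m, h, rfl⟩))

theorem X_pow_mul_esymmOn_mem_subsetIdeal {n : ℕ} {T : Finset (Fin n)} {a : Fin n} (ha : a ∉ T)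
    (k : ℕ) {s : ℕ} (t : ℕ) (hts : t ≤ s) (m : ℕ) (h : T.card < m + t) :
    X a ^ t * esymmOn n T m ∈ subsetIdeal (insert a T) k s := by
  induction t generalizing m with
  | zero =>
    rw [esymmOn_eq_zero (by omega), mul_zero]
    exact zero_mem _
  | succ t ih =>
    have h1 : X a ^ (t + 1) * esymmOn n T m =
        X a ^ t * esymmOn n (insert a T) (m + 1) - X a ^ t * esymmOn n T (m + 1) := by
      rw [esymmOn_insert ha]
      ring
    rw [h1]
    refine sub_mem (Ideal.mul_mem_left _ _ (esymmOn_mem_subsetIdeal ?_))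
      (ih (by omega) _ (by omega))
    rw [Finset.card_insert_of_notMem ha]
    omega

/-- The number of words of length `n` over an alphabet of `k` letters in which `s` prescribed
letters all occur. -/
def wordCount (k : ℕ) : ℕ → ℕ → ℕ
  | 0, 0 => 1
  | 0, _ + 1 => 0
  | n + 1, s => s * wordCount k n (s - 1) + (k - s) * wordCount k n s

theorem exists_monomials_spanning {n : ℕ} (k : ℕ) (T : Finset (Fin n)) (s : ℕ) (hs : s ≤ k) :
    ∃ B : Finset (Fin n →₀ ℕ), B.card ≤ wordCount k T.card s ∧
      ∀ p : MvPolynomial (Fin n) ℚ, ∃ q ∈ Submodule.span ℚ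
        ((fun m => (monomial m (1 : ℚ) : MvPolynomial (Fin n) ℚ)) '' (B : Set (Fin n →₀ ℕ))),
          p - q ∈ subsetIdeal T k s := by
  classical
  induction T using Finset.induction_on generalizing s with
  | empty =>
    cases s with
    | zero =>
      refine ⟨{0}, by simp [wordCount], fun p => ⟨C (coeff 0 p), ?_, ?_⟩⟩
      · rw [← mul_one (C (coeff 0 p)), ← smul_eq_C_mul]
        exact Submodule.smul_mem _ _ (Submodule.subset_span ⟨0, by simp, rfl⟩)
      · induction p using MvPolynomial.induction_on with
        | C a => simp
        | add p q hp hq =>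
          rw [coeff_add, C_add, add_sub_add_comm]
          exact add_mem hp hq
        | mul_X p i _ =>
          rw [show coeff 0 (p * X i) = 0 by simp [coeff_mul_X'], C_0, sub_zero]
          exact Ideal.mul_mem_left _ _ (X_mem_subsetIdeal (by simp))
    | succ s =>
      refine ⟨∅, by simp, fun p => ⟨0, zero_mem _, ?_⟩⟩
      have h1 : (1 : MvPolynomial (Fin n) ℚ) ∈ subsetIdeal ∅ k (s + 1) := by
        rw [← esymmOn_zero n ∅]
        exact esymmOn_mem_subsetIdeal (by simp)
      rw [(Ideal.eq_top_iff_one _).2 h1]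
      trivial
  | insert a T ha ih =>
    have hle : ∀ i, (if i < s then s - 1 else s) ≤ k := by
      intro i
      split_ifs <;> omega
    choose B hBcard hB using fun i => ih _ (hle i)
    let B' := (Finset.range k).biUnion fun i => (B i).image fun m => Finsupp.single a i + m
    refine ⟨B', ?_, ?_⟩
    · calc B'.card ≤ ∑ i ∈ Finset.range k, (B i).card :=
            Finset.card_biUnion_le.trans (Finset.sum_le_sum fun i _ => Finset.card_image_le)
        _ ≤ ∑ i ∈ Finset.range k, if i < s then wordCount k T.card (s - 1)
              else wordCount k T.card s := by
            refine Finset.sum_le_sum fun i _ => (hBcard i).trans (le_of_eq ?_)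
            split_ifs <;> rfl
        _ = wordCount k (insert a T).card s := by
            obtain ⟨t, rfl⟩ := Nat.exists_eq_add_of_le hs
            rw [Finset.card_insert_of_notMem ha, wordCount, Finset.sum_range_add,
              Finset.sum_congr rfl fun i hi => if_pos (Finset.mem_range.1 hi)]
            simp
    · let M := Submodule.span ℚ
        ((fun m => (monomial m (1 : ℚ) : MvPolynomial (Fin n) ℚ)) '' (B' : Set (Fin n →₀ ℕ))) ⊔
          (subsetIdeal (insert a T) k s).restrictScalars ℚ
      have hIM : ∀ x ∈ subsetIdeal (insert a T) k s, x ∈ M := fun x hx =>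
        Submodule.mem_sup_right (show x ∈ (subsetIdeal (insert a T) k s).restrictScalars ℚ from hx)
      have key : ∀ t i, i + t = k → ∀ p : MvPolynomial (Fin n) ℚ, X a ^ i * p ∈ M := by
        intro t
        induction t with
        | zero =>
          rintro i rfl p
          exact hIM _ (Ideal.mul_mem_right _ _ (X_pow_mem_subsetIdeal (Finset.mem_insert_self a T)))
        | succ t iht =>
          intro i hi p
          obtain ⟨q, hq, hpq⟩ := hB i p
          have hstep : ∀ f, X a ^ (i + 1) * f ∈ M := iht (i + 1) (by omega)
          have h1 : X a ^ i * q ∈ M := by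
            refine Submodule.mem_sup_left ?_
            clear hpq
            induction hq using Submodule.span_induction with
            | mem y hy =>
              obtain ⟨m, hm, rfl⟩ := hy
              refine Submodule.subset_span ⟨Finsupp.single a i + m, ?_, ?_⟩
              · exact Finset.mem_biUnion.2 ⟨i, Finset.mem_range.2 (by omega),
                  Finset.mem_image_of_mem _ hm⟩
              · simp only
                rw [X_pow_eq_monomial, monomial_mul, one_mul]
            | zero => simp
            | add y z _ _ hy hz =>
              rw [mul_add]
              exact add_mem hy hz
            | smul c y _ hy =>
              rw [mul_smul_comm]
              exact Submodule.smul_mem _ c hy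
          have h2 : X a ^ i * (p - q) ∈ M := by
            refine ideal_span_induction (P := fun f => X a ^ i * f ∈ M) ?_ ?_ ?_ hpq
            · simp
            · intro x y hx hy
              rw [mul_add]
              exact add_mem hx hy
            · rintro b g (⟨j, hj, rfl⟩ | ⟨j, hj, rfl⟩ | ⟨m, hm, rfl⟩)
              · by_cases hja : j = a
                · subst hja
                  convert hstep b using 1
                  ring
                · exact hIM _ (Ideal.mul_mem_left _ _ (Ideal.mul_mem_left _ _
                    (X_mem_subsetIdeal (by simp [hja, hj]))))
              · exact hIM _ (Ideal.mul_mem_left _ _ (Ideal.mul_mem_left _ _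
                  (X_pow_mem_subsetIdeal (Finset.mem_insert_of_mem hj))))
              · split_ifs at hm with his
                · cases m with
                  | zero =>
                    rw [esymmOn_zero, ← esymmOn_zero n (insert a T)]
                    refine hIM _ (Ideal.mul_mem_left _ _ (Ideal.mul_mem_left _ _
                      (esymmOn_mem_subsetIdeal ?_)))
                    rw [Finset.card_insert_of_notMem ha]
                    omega
                  | succ m =>
                    have h3 : X a ^ i * (b * esymmOn n T (m + 1)) =
                        X a ^ i * (b * esymmOn n (insert a T) (m + 1)) -
                          X a ^ (i + 1) * (b * esymmOn n T m) := by
                      rw [esymmOn_insert ha]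
                      ring
                    rw [h3]
                    refine sub_mem (hIM _ (Ideal.mul_mem_left _ _ (Ideal.mul_mem_left _ _
                      (esymmOn_mem_subsetIdeal ?_)))) (hstep _)
                    rw [Finset.card_insert_of_notMem ha]
                    omega
                · obtain ⟨u, rfl⟩ := Nat.exists_eq_add_of_le (not_lt.1 his)
                  have h3 : X a ^ (s + u) * (b * esymmOn n T m) =
                      (X a ^ u * b) * (X a ^ s * esymmOn n T m) := by
                    ring
                  rw [h3]
                  exact hIM _ (Ideal.mul_mem_left _ _
                    (X_pow_mul_esymmOn_mem_subsetIdeal ha k s le_rfl m hm))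
          have h3 := add_mem h1 h2
          rwa [← mul_add, add_sub_cancel] at h3
      intro p
      have hp := key k 0 (by omega) p
      rw [pow_zero, one_mul] at hp
      obtain ⟨q, hq, r, hr, rfl⟩ := Submodule.mem_sup.1 hp
      exact ⟨q, hq, by simpa using hr⟩

theorem card_words (k n : ℕ) (S : Finset (Fin k)) :
    Fintype.card {f : Fin n → Fin k // ∀ a ∈ S, ∃ i, f i = a} = wordCount k n S.card := by
  classical
  induction n generalizing S with
  | zero =>
    rcases S.eq_empty_or_nonempty with rfl | ⟨a, ha⟩
    · simp [wordCount]
    · obtain ⟨c, hc⟩ := Nat.exists_eq_succ_of_ne_zero (Finset.card_pos.2 ⟨a, ha⟩).ne'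
      rw [hc, wordCount, Fintype.card_eq_zero_iff]
      exact ⟨fun f => (f.2 a ha).elim fun i _ => i.elim0⟩
  | succ n ih =>
    let E : {f : Fin (n + 1) → Fin k // ∀ a ∈ S, ∃ i, f i = a} ≃
        Σ b : Fin k, {f : Fin n → Fin k // ∀ a ∈ S.erase b, ∃ i, f i = a} :=
      { toFun := fun f => ⟨f.1 0, fun i => f.1 i.succ, fun a ha => by
          obtain ⟨hab, haS⟩ := Finset.mem_erase.1 ha
          obtain ⟨i, hi⟩ := f.2 a haS
          cases i using Fin.cases with
          | zero => exact absurd hi.symm hab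
          | succ i => exact ⟨i, hi⟩⟩
        invFun := fun g => ⟨Fin.cons g.1 g.2.1, fun a ha => by
          by_cases hab : a = g.1
          · exact ⟨0, by simp [hab]⟩
          · obtain ⟨i, hi⟩ := g.2.2 a (Finset.mem_erase.2 ⟨hab, ha⟩)
            exact ⟨i.succ, by simpa using hi⟩⟩
        left_inv := fun f => Subtype.ext (Fin.cons_self_tail f.1)
        right_inv := fun g => rfl }
    rw [Fintype.card_congr E, Fintype.card_sigma, Finset.sum_congr rfl fun b _ => ih (S.erase b),
      ← Finset.sum_add_sum_compl S,
      Finset.sum_congr rfl fun b hb => by rw [Finset.card_erase_of_mem hb],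
      Finset.sum_congr (s₁ := Sᶜ) rfl fun b hb => by
        rw [Finset.erase_eq_of_notMem (Finset.mem_compl.1 hb)]]
    simp [wordCount, Finset.card_compl]

theorem isHomogeneous_of_mem_Ink {n k : ℕ} {f : MvPolynomial (Fin n) ℚ} (hf : f ∈ Ink n k)
    (d : ℕ) : homogeneousComponent d f ∈ Ink n k := by
  refine homogeneousComponent_mem_span ?_ hf d
  rintro g (⟨i, rfl⟩ | ⟨j, -, -, rfl⟩)
  · exact ⟨k, isHomogeneous_X_pow i k⟩
  · exact ⟨j, isHomogeneous_esymmOn n _ j⟩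

theorem sum_finrank_quotComp_Ink_le {n k : ℕ} (hkn : k ≤ n) (D : ℕ) :
    ∑ d ∈ Finset.range D, Module.finrank ℚ (quotComp n (Ink n k) d) ≤ wordCount k n k := by
  obtain ⟨B, hcard, hB⟩ := exists_monomials_spanning k (Finset.univ : Finset (Fin n)) k le_rfl
  rw [Finset.card_univ, Fintype.card_fin] at hcard
  have hle : subsetIdeal (Finset.univ : Finset (Fin n)) k k ≤ Ink n k := by
    refine Ideal.span_le.2 ?_
    rintro g (⟨i, hi, rfl⟩ | ⟨i, -, rfl⟩ | ⟨m, hm, rfl⟩)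
    · simp at hi
    · exact Ideal.subset_span (Or.inl ⟨i, rfl⟩)
    · rw [Finset.card_univ, Fintype.card_fin] at hm
      rcases le_or_gt m n with h | h
      · exact Ideal.subset_span (Or.inr ⟨m, by omega, h, rfl⟩)
      · rw [esymmOn_eq_zero (by simpa using h)]
        exact zero_mem _
  refine (sum_finrank_quotComp_le_card (fun f hf d => isHomogeneous_of_mem_Ink hf d) B
    (fun p => ?_) D).trans hcard
  obtain ⟨q, hq, hpq⟩ := hB p
  exact ⟨q, hq, hle hpq⟩

/-- The generators `e_m` with `m > n - k`, without truncated subtraction. -/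
theorem Jnk_eq {n k : ℕ} (hkn : k ≤ n) :
    Jnk n k = Jn n ⊔ Ideal.span {g | ∃ m, n < m + k ∧ g = esymmOn n Finset.univ m} := by
  refine le_antisymm (sup_le_sup_left (Ideal.span_mono ?_) _) (sup_le_sup_left ?_ _)
  · rintro g ⟨j, h1, -, rfl⟩
    exact ⟨j, by omega, rfl⟩
  · refine Ideal.span_le.2 ?_
    rintro g ⟨m, hm, rfl⟩
    rcases le_or_gt m n with h | h
    · exact Ideal.subset_span ⟨m, by omega, h, rfl⟩
    · rw [esymmOn_eq_zero (by simpa using h)]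
      exact zero_mem _

/-- The ideal `J_{n,k}`, including the case `k = n + 1` in which it is the unit ideal. -/
noncomputable def packedIdeal (n k : ℕ) : Ideal (MvPolynomial (Fin n) ℚ) :=
  Jn n ⊔ Ideal.span {g | ∃ m, n < m + k ∧ g = esymmOn n Finset.univ m}

theorem packedIdeal_succ {n k : ℕ} (hkn : k ≤ n) :
    packedIdeal n (k + 1) = packedIdeal n k ⊔ Ideal.span {esymmOn n Finset.univ (n - k)} := by
  rw [packedIdeal, packedIdeal, sup_assoc, ← Ideal.span_union]
  congr 2
  ext g
  constructor
  · rintro ⟨m, hm, rfl⟩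
    rcases Nat.lt_or_ge n (m + k) with h | h
    · exact Or.inl ⟨m, h, rfl⟩
    · exact Or.inr (by rw [show m = n - k by omega]; rfl)
  · rintro (⟨m, hm, rfl⟩ | rfl)
    · exact ⟨m, by omega, rfl⟩
    · exact ⟨n - k, by omega, rfl⟩

theorem X_pow_mul_esymmOn_mem_packedIdeal {n k : ℕ} (i : Fin n) {r : ℕ} (hr : 1 ≤ r) :
    X i ^ r * esymmOn n {i}ᶜ (n - r) ∈ packedIdeal n k :=
  Ideal.mem_sup_left (Ideal.subset_span ⟨i, r, r, hr, le_rfl, rfl⟩)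

theorem packedIdeal_generator {n k : ℕ} {P : MvPolynomial (Fin n) ℚ → Prop} (zero : P 0)
    (add : ∀ x y, P x → P y → P (x + y))
    (gen : ∀ a (i : Fin n) r, 1 ≤ r → r ≤ n → P (a * (X i ^ r * esymmOn n {i}ᶜ (n - r))))
    (esymm : ∀ a m, n < m + k → P (a * esymmOn n Finset.univ m))
    {f : MvPolynomial (Fin n) ℚ} (hf : f ∈ packedIdeal n k) : P f := by
  rw [packedIdeal, Jn, ← Ideal.span_union] at hf
  refine ideal_span_induction zero add ?_ hf
  rintro a g (⟨i, r, d, hr, hrd, rfl⟩ | ⟨m, hm, rfl⟩)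
  · obtain ⟨t, rfl⟩ := Nat.exists_eq_add_of_le hrd
    rcases le_or_gt r n with h | h
    · have := gen (a * X i ^ t) i r hr h
      convert this using 1
      ring
    · obtain ⟨u, rfl⟩ := Nat.exists_eq_add_of_le h.le
      have := gen (a * X i ^ (u + t)) i n i.pos le_rfl
      convert this using 1
      rw [show n - (n + u) = n - n by omega]
      ring
  · exact esymm a m hm

theorem isHomogeneous_X_pow_mul_esymmOn {n : ℕ} (i : Fin n) {r : ℕ} (hr : r ≤ n) :
    (X i ^ r * esymmOn n {i}ᶜ (n - r)).IsHomogeneous n := by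
  have h := (isHomogeneous_X_pow (R := ℚ) i r).mul (isHomogeneous_esymmOn n {i}ᶜ (n - r))
  rwa [Nat.add_sub_cancel' hr] at h

theorem homogeneousComponent_mem_packedIdeal {n k : ℕ} {f : MvPolynomial (Fin n) ℚ}
    (hf : f ∈ packedIdeal n k) (d : ℕ) : homogeneousComponent d f ∈ packedIdeal n k := by
  refine packedIdeal_generator (P := fun f => homogeneousComponent d f ∈ packedIdeal n k)
    ?_ ?_ ?_ ?_ hf
  · simp
  · intro x y hx hy
    rw [map_add]
    exact add_mem hx hy
  · intro a i r hr hrn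
    rw [homogeneousComponent_mul_of_isHomogeneous a (isHomogeneous_X_pow_mul_esymmOn i hrn)]
    split_ifs
    · exact Ideal.mul_mem_left _ _ (X_pow_mul_esymmOn_mem_packedIdeal i hr)
    · exact zero_mem _
  · intro a m hm
    rw [homogeneousComponent_mul_of_isHomogeneous a (isHomogeneous_esymmOn n _ m)]
    split_ifs
    · exact Ideal.mul_mem_left _ _ (Ideal.mem_sup_right (Ideal.subset_span ⟨m, hm, rfl⟩))
    · exact zero_mem _

theorem esymmOn_univ_succ {n : ℕ} (i : Fin n) (m : ℕ) :
    esymmOn n Finset.univ (m + 1) = esymmOn n {i}ᶜ (m + 1) + X i * esymmOn n {i}ᶜ m := by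
  rw [← esymmOn_insert (by simp), Finset.insert_compl_self]

/-- `I_{n,k}` annihilates `e_{n-k}` modulo `J_{n,k}`. -/
theorem mul_esymmOn_mem_packedIdeal {n k : ℕ} (hk : 1 ≤ k) (hkn : k ≤ n)
    {f : MvPolynomial (Fin n) ℚ} (hf : f ∈ Ink n k) :
    f * esymmOn n Finset.univ (n - k) ∈ packedIdeal n k := by
  refine ideal_span_induction (P := fun f => f * esymmOn n Finset.univ (n - k) ∈ packedIdeal n k)
    ?_ ?_ ?_ hf
  · simp
  · intro x y hx hy
    rw [add_mul]
    exact add_mem hx hy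
  · rintro a g (⟨i, rfl⟩ | ⟨j, hj, -, rfl⟩)
    · rw [mul_assoc]
      refine Ideal.mul_mem_left _ _ ?_
      have h0 := X_pow_mul_esymmOn_mem_packedIdeal (k := k) i hk
      rcases hkn.eq_or_lt with rfl | h
      · rw [Nat.sub_self, esymmOn_zero] at h0 ⊢
        exact h0
      · have h1 := X_pow_mul_esymmOn_mem_packedIdeal (k := k) i (show 1 ≤ k + 1 by omega)
        obtain ⟨t, rfl⟩ := Nat.exists_eq_add_of_lt h
        rw [show k + t + 1 - k = t + 1 by omega] at h0 ⊢
        rw [show k + t + 1 - (k + 1) = t by omega] at h1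
        have h2 := add_mem h0 h1
        rw [esymmOn_univ_succ i]
        convert h2 using 1
        ring
    · refine Ideal.mul_mem_right _ _ (Ideal.mul_mem_left _ _ ?_)
      exact Ideal.mem_sup_right (Ideal.subset_span ⟨j, by omega, rfl⟩)

theorem finrank_quotComp_packedIdeal_le {n k : ℕ} (hk : 1 ≤ k) (hkn : k ≤ n + 1) (d : ℕ) :
    Module.finrank ℚ (quotComp n (packedIdeal n k) d) ≤
      ∑ j ∈ Finset.Icc k n, Module.finrank ℚ (quotCompShift n (Ink n j) d (n - j)) := by
  induction hkn using Nat.decreasingInduction with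
  | self =>
    have h1 : packedIdeal n (n + 1) = ⊤ := by
      refine (Ideal.eq_top_iff_one _).2 (Ideal.mem_sup_right (Ideal.subset_span ⟨0, by omega, ?_⟩))
      rw [esymmOn_zero]
    have : Subsingleton (MvPolynomial (Fin n) ℚ ⧸ packedIdeal n (n + 1)) :=
      Ideal.Quotient.subsingleton_iff.2 h1
    rw [Module.finrank_zero_of_subsingleton]
    exact Nat.zero_le _
  | of_succ k hkn ih =>
    have hkn' : k ≤ n := Nat.lt_succ_iff.1 hkn
    refine (finrank_quotComp_le_add (isHomogeneous_esymmOn n Finset.univ (n - k))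
      (fun f hf d => homogeneousComponent_mem_packedIdeal hf d)
      (fun f hf => mul_esymmOn_mem_packedIdeal hk hkn' hf) d).trans ?_
    rw [← packedIdeal_succ hkn', ← Finset.insert_Icc_succ_left_eq_Icc hkn',
      Finset.sum_insert (by simp), add_comm]
    exact Nat.add_le_add_left (ih (by omega)) _

section Evaluation

variable {n : ℕ} {ι : Type*} (w : ι → Fin n → ℕ)

/-- Evaluation of polynomials at all the points of a family. -/
noncomputable def evalAt : MvPolynomial (Fin n) ℚ →ₐ[ℚ] (ι → ℚ) :=
  aeval fun i x => (w x i : ℚ)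

theorem evalAt_apply (p : MvPolynomial (Fin n) ℚ) (x : ι) :
    evalAt w p x = eval (fun i => (w x i : ℚ)) p := by
  induction p using MvPolynomial.induction_on with
  | C a => simp [evalAt]
  | add p q hp hq => simp [hp, hq]
  | mul_X p i hp => rw [map_mul, map_mul, Pi.mul_apply, hp]; simp [evalAt]

/-- The functions given by polynomials of degree less than `d`. -/
noncomputable def lowDegree (d : ℕ) : Submodule ℚ (ι → ℚ) :=
  Submodule.span ℚ ((fun m => evalAt w (monomial m 1)) '' {m | m.degree < d})

variable {w}

theorem lowDegree_mono {a b : ℕ} (h : a ≤ b) : lowDegree w a ≤ lowDegree w b :=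
  Submodule.span_mono (Set.image_mono fun _ hm => lt_of_lt_of_le hm h)

theorem lowDegree_zero : lowDegree w 0 = ⊥ := by
  simp [lowDegree]

theorem evalAt_mem_lowDegree {p : MvPolynomial (Fin n) ℚ} {d : ℕ}
    (hp : ∀ m ∈ p.support, m.degree < d) : evalAt w p ∈ lowDegree w d := by
  rw [p.as_sum, map_sum]
  refine sum_mem fun m hm => ?_
  have h : (monomial m (coeff m p) : MvPolynomial (Fin n) ℚ) = coeff m p • monomial m 1 := by
    rw [smul_monomial, smul_eq_mul, mul_one]
  rw [h, map_smul]
  exact Submodule.smul_mem _ _ (Submodule.subset_span ⟨m, hp m hm, rfl⟩)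

theorem evalAt_mem_lowDegree_of_isHomogeneous {p : MvPolynomial (Fin n) ℚ} {a d : ℕ}
    (hp : p.IsHomogeneous a) (h : a < d) : evalAt w p ∈ lowDegree w d := by
  refine evalAt_mem_lowDegree fun m hm => ?_
  by_contra hlt
  exact mem_support_iff.1 hm (hp.coeff_eq_zero (by omega))

theorem mul_mem_lowDegree {a b : ℕ} {u v : ι → ℚ} (hu : u ∈ lowDegree w a)
    (hv : v ∈ lowDegree w (b + 1)) : u * v ∈ lowDegree w (a + b) := by
  have h := Submodule.mul_mem_mul hu hv
  rw [lowDegree, lowDegree, Submodule.span_mul_span] at h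
  refine Submodule.span_mono ?_ h
  rintro _ ⟨_, ⟨m, hm, rfl⟩, _, ⟨m', hm', rfl⟩, rfl⟩
  refine ⟨m + m', ?_, ?_⟩
  · simp only [Set.mem_ofPred_eq, map_add] at hm hm' ⊢
    omega
  · simp only
    rw [← map_mul, monomial_mul, one_mul]

theorem coeff_prod_one_add (x : Fin n → ℚ) (T : Finset (Fin n)) (m : ℕ) :
    PowerSeries.coeff m (∏ i ∈ T, (1 + PowerSeries.C (x i) * PowerSeries.X)) =
      eval x (esymmOn n T m) := by
  classical
  induction T using Finset.induction_on generalizing m with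
  | empty =>
    cases m with
    | zero => simp [esymmOn_zero]
    | succ m => rw [esymmOn_eq_zero (by simp)]; simp [PowerSeries.coeff_one]
  | insert a T ha ih =>
    rw [Finset.prod_insert ha, add_mul, one_mul, map_add, ih, mul_assoc, PowerSeries.coeff_C_mul]
    cases m with
    | zero => simp [esymmOn_zero]
    | succ m => rw [PowerSeries.coeff_succ_X_mul, ih, esymmOn_insert ha]; simp

/-- The coefficients of the inverse of `∏_{a < r} (1 + a t)`. -/
noncomputable def invCoeff (r j : ℕ) : ℚ :=
  PowerSeries.coeff j
    (∏ a ∈ Finset.range r, (1 + PowerSeries.C (a : ℚ) * PowerSeries.X))⁻¹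

theorem invCoeff_zero (r : ℕ) : invCoeff r 0 = 1 := by
  simp [invCoeff, map_prod]

theorem sum_invCoeff_mul_esymmOn_eq_zero (x : Fin n → ℕ) (T : Finset (Fin n)) (r m : ℕ)
    (hx : ∀ a < r, ∃ i ∈ T, x i = a) (hm : T.card < m + r) :
    ∑ j ∈ Finset.range (m + 1),
      invCoeff r (m - j) * eval (fun i => (x i : ℚ)) (esymmOn n T j) = 0 := by
  classical
  choose c hcT hcx using fun a : Fin r => hx a a.2
  have hinj : Function.Injective c := by
    intro a b hab
    rw [Fin.ext_iff, ← hcx a, ← hcx b, hab]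
  let U := Finset.univ.image c
  have hU : U ⊆ T := by
    intro i hi
    obtain ⟨a, ha, rfl⟩ := Finset.mem_image.1 hi
    exact hcT a
  have hUcard : U.card = r := by
    rw [Finset.card_image_of_injective _ hinj, Finset.card_univ, Fintype.card_fin]
  let F : ℚ → PowerSeries ℚ := fun a => 1 + PowerSeries.C a * PowerSeries.X
  have hF : ∏ i ∈ U, F (x i) = ∏ a ∈ Finset.range r, F a := by
    rw [Finset.prod_image hinj.injOn, Finset.prod_range]
    exact Finset.prod_congr rfl fun a _ => by rw [hcx a]
  have hne : PowerSeries.constantCoeff (∏ a ∈ Finset.range r, F a) ≠ 0 := by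
    simp [F, map_prod]
  have h1 := coeff_prod_one_add (fun i => (x i : ℚ)) (T \ U) m
  rw [esymmOn_eq_zero (by
    have := Finset.card_le_card hU
    rw [Finset.card_sdiff_of_subset hU]
    omega), map_zero] at h1
  have h2 : (∏ i ∈ T, F (x i)) * (∏ a ∈ Finset.range r, F a)⁻¹ = ∏ i ∈ T \ U, F (x i) := by
    rw [← Finset.prod_sdiff hU, hF, mul_assoc, PowerSeries.mul_inv_cancel _ hne, mul_one]
  rw [← h2, PowerSeries.coeff_mul, Finset.Nat.sum_antidiagonal_eq_sum_range_succ_mk] at h1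
  rw [← h1]
  refine Finset.sum_congr rfl fun j _ => ?_
  rw [← coeff_prod_one_add, mul_comm]
  rfl

/-- Correcting `e_m` by lower-order terms so that it vanishes at all words that contain the
letters `0, …, r - 1` at positions of `T`, when `m > |T| - r`. -/
noncomputable def correctedEsymm (w : ι → Fin n → ℕ) (T : Finset (Fin n)) (r m : ℕ) : ι → ℚ :=
  ∑ j ∈ Finset.range (m + 1), invCoeff r (m - j) • evalAt w (esymmOn n T j)

theorem correctedEsymm_apply_eq_zero {T : Finset (Fin n)} {r m : ℕ} {x : ι}
    (hx : ∀ a < r, ∃ i ∈ T, w x i = a) (hm : T.card < m + r) :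
    correctedEsymm w T r m x = 0 := by
  rw [correctedEsymm, Finset.sum_apply, ← sum_invCoeff_mul_esymmOn_eq_zero (w x) T r m hx hm]
  refine Finset.sum_congr rfl fun j _ => ?_
  rw [Pi.smul_apply, evalAt_apply, smul_eq_mul]

theorem correctedEsymm_sub_mem (T : Finset (Fin n)) (r m : ℕ) :
    correctedEsymm w T r m - evalAt w (esymmOn n T m) ∈ lowDegree w m := by
  rw [correctedEsymm, Finset.sum_range_succ, Nat.sub_self, invCoeff_zero, one_smul,
    add_sub_cancel_right]
  exact sum_mem fun j hj => Submodule.smul_mem _ _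
    (evalAt_mem_lowDegree_of_isHomogeneous (isHomogeneous_esymmOn n T j) (Finset.mem_range.1 hj))

theorem evalAt_esymmOn_univ_mem {k m : ℕ} (hw : ∀ x, ∀ a < k, ∃ i, w x i = a) (hm : n < m + k) :
    evalAt w (esymmOn n Finset.univ m) ∈ lowDegree w m := by
  have h0 : correctedEsymm w Finset.univ k m = 0 := by
    ext x
    exact correctedEsymm_apply_eq_zero (by simpa using hw x) (by simpa using hm)
  have h := correctedEsymm_sub_mem (w := w) Finset.univ k m
  rw [h0, zero_sub] at h
  exact neg_mem_iff.1 h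

theorem prod_sub_sub_pow_mem (i : Fin n) (r : ℕ) :
    ∏ a ∈ Finset.range r, (evalAt w (X i) - a) - evalAt w (X i ^ r) ∈ lowDegree w r := by
  induction r with
  | zero => simp
  | succ r ih =>
    have h1 : (r : ι → ℚ) = evalAt w (C (r : ℚ)) := by
      rw [← map_natCast (evalAt w) r, map_natCast C]
    have h2 : evalAt w (X i) - r ∈ lowDegree w (1 + 1) := by
      rw [h1]
      exact sub_mem (evalAt_mem_lowDegree_of_isHomogeneous (isHomogeneous_X ℚ i) (by omega))
        (evalAt_mem_lowDegree_of_isHomogeneous (isHomogeneous_C _ _) (by omega))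
    have h3 : evalAt w (X i ^ r) * r ∈ lowDegree w (r + 1 + 0) := by
      rw [h1]
      exact mul_mem_lowDegree
        (evalAt_mem_lowDegree_of_isHomogeneous (isHomogeneous_X_pow i r) (by omega))
        (evalAt_mem_lowDegree_of_isHomogeneous (isHomogeneous_C _ _) (by omega))
    have h4 := sub_mem (mul_mem_lowDegree ih h2) h3
    rw [Finset.prod_range_succ]
    convert h4 using 1
    rw [pow_succ, map_mul]
    ring

theorem evalAt_X_pow_mul_esymmOn_mem (hw : ∀ x p, ∀ a < w x p, ∃ q, w x q = a) (i : Fin n)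
    {r : ℕ} (hr : 1 ≤ r) (hrn : r ≤ n) :
    evalAt w (X i ^ r * esymmOn n {i}ᶜ (n - r)) ∈ lowDegree w n := by
  set P : ι → ℚ := ∏ a ∈ Finset.range r, (evalAt w (X i) - a) with hP
  set Q := correctedEsymm w {i}ᶜ r (n - r) with hQ
  have hPQ : P * Q = 0 := by
    ext x
    rw [Pi.mul_apply, Pi.zero_apply]
    rcases lt_or_ge (w x i) r with h | h
    · refine mul_eq_zero_of_left ?_ _
      rw [hP, Finset.prod_apply]
      refine Finset.prod_eq_zero (Finset.mem_range.2 h) ?_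
      simp [evalAt_apply]
    · refine mul_eq_zero_of_right _ (correctedEsymm_apply_eq_zero ?_ ?_)
      · intro a ha
        obtain ⟨q, hq⟩ := hw x i a (by omega)
        refine ⟨q, ?_, hq⟩
        rw [Finset.mem_compl, Finset.mem_singleton]
        rintro rfl
        omega
      · rw [Finset.card_compl, Fintype.card_fin, Finset.card_singleton]
        omega
  have h1 : Q - evalAt w (esymmOn n {i}ᶜ (n - r)) ∈ lowDegree w (n - r) :=
    correctedEsymm_sub_mem _ _ _
  have h2 : Q ∈ lowDegree w (n - r + 1) := by
    have := add_mem (lowDegree_mono (Nat.le_succ _) h1)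
      (evalAt_mem_lowDegree_of_isHomogeneous (w := w)
        (isHomogeneous_esymmOn n {i}ᶜ (n - r)) (Nat.lt_succ_self _))
    rwa [sub_add_cancel] at this
  have h3 := mul_mem_lowDegree (prod_sub_sub_pow_mem i r) h2
  have h4 := mul_mem_lowDegree h1 (evalAt_mem_lowDegree_of_isHomogeneous (w := w)
    (isHomogeneous_X_pow i r) (Nat.lt_succ_self r))
  rw [Nat.add_sub_cancel' hrn] at h3
  rw [Nat.sub_add_cancel hrn] at h4
  have h5 := neg_mem (add_mem h3 h4)
  rw [← hP] at h5
  convert h5 using 1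
  rw [map_mul]
  linear_combination hPQ

theorem evalAt_mem_lowDegree_of_mem_packedIdeal {k : ℕ}
    (hw : ∀ x p, ∀ a < w x p, ∃ q, w x q = a) (hwk : ∀ x, ∀ a < k, ∃ i, w x i = a)
    {f : MvPolynomial (Fin n) ℚ} (hf : f ∈ packedIdeal n k) (d : ℕ) :
    evalAt w (homogeneousComponent d f) ∈ lowDegree w d := by
  have hmul : ∀ (a g : MvPolynomial (Fin n) ℚ) (c : ℕ), g.IsHomogeneous c →
      evalAt w g ∈ lowDegree w c →
        evalAt w (homogeneousComponent d (a * g)) ∈ lowDegree w d := by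
    intro a g c hg hgc
    rw [homogeneousComponent_mul_of_isHomogeneous a hg]
    split_ifs with h
    · have := mul_mem_lowDegree hgc (evalAt_mem_lowDegree_of_isHomogeneous (w := w)
        (homogeneousComponent_isHomogeneous (d - c) a) (Nat.lt_succ_self _))
      rwa [Nat.add_sub_cancel' h, ← map_mul, mul_comm] at this
    · rw [map_zero]
      exact zero_mem _
  refine packedIdeal_generator
    (P := fun f => evalAt w (homogeneousComponent d f) ∈ lowDegree w d) ?_ ?_ ?_ ?_ hf
  · simp
  · intro x y hx hy
    rw [map_add, map_add]
    exact add_mem hx hy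
  · intro a i r hr hrn
    exact hmul _ _ n (isHomogeneous_X_pow_mul_esymmOn i hrn)
      (evalAt_X_pow_mul_esymmOn_mem hw i hr hrn)
  · intro a m hm
    exact hmul _ _ m (isHomogeneous_esymmOn n _ m) (evalAt_esymmOn_univ_mem hwk hm)

variable [Finite ι]

theorem finrank_lowDegree_succ_le {J : Ideal (MvPolynomial (Fin n) ℚ)}
    (hJ : ∀ f ∈ J, ∀ d, evalAt w (homogeneousComponent d f) ∈ lowDegree w d) (d : ℕ) :
    Module.finrank ℚ (lowDegree w (d + 1)) ≤
      Module.finrank ℚ (lowDegree w d) + Module.finrank ℚ (quotComp n J d) := by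
  let b := Module.finBasis ℚ (quotComp n J d)
  choose p hp hpb using fun i => mem_quotComp.1 (b i).2
  have hle : lowDegree w (d + 1) ≤
      lowDegree w d ⊔ Submodule.span ℚ (Set.range fun i => evalAt w (p i)) := by
    refine Submodule.span_le.2 ?_
    rintro _ ⟨m, hm, rfl⟩
    rcases Nat.lt_succ_iff_lt_or_eq.1 hm with h | h
    · exact Submodule.mem_sup_left (Submodule.subset_span ⟨m, h, rfl⟩)
    · have hmh : (monomial m (1 : ℚ) : MvPolynomial (Fin n) ℚ).IsHomogeneous d :=
        isHomogeneous_monomial 1 h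
      let y : quotComp n J d := ⟨Ideal.Quotient.mk J (monomial m 1), mem_quotComp.2 ⟨_, hmh, rfl⟩⟩
      have hy := congrArg Subtype.val (b.sum_repr y)
      rw [Submodule.coe_sum] at hy
      have hq : Ideal.Quotient.mk J (monomial m 1) =
          Ideal.Quotient.mk J (∑ i, b.repr y i • p i) := by
        rw [map_sum, ← show (y : MvPolynomial (Fin n) ℚ ⧸ J) =
          Ideal.Quotient.mk J (monomial m 1) from rfl, ← hy]
        refine Finset.sum_congr rfl fun i _ => ?_
        rw [Submodule.coe_smul, ← hpb i]
        rfl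
      have h1 := hJ _ (Ideal.Quotient.eq.1 hq) d
      have hsum : (∑ i, b.repr y i • p i).IsHomogeneous d :=
        sum_mem (S := homogeneousSubmodule (Fin n) ℚ d) fun i _ =>
          Submodule.smul_mem _ _ (hp i)
      rw [homogeneousComponent_eq_self (hmh.sub hsum), map_sub] at h1
      have h2 : evalAt w (∑ i, b.repr y i • p i) ∈
          Submodule.span ℚ (Set.range fun i => evalAt w (p i)) := by
        rw [map_sum]
        refine sum_mem fun i _ => ?_
        rw [map_smul]
        exact Submodule.smul_mem _ _ (Submodule.subset_span ⟨i, rfl⟩)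
      have h3 := add_mem (Submodule.mem_sup_left h1) (Submodule.mem_sup_right h2)
      rwa [sub_add_cancel] at h3
  refine (Submodule.finrank_mono hle).trans
    ((Submodule.finrank_add_le_finrank_add_finrank _ _).trans (Nat.add_le_add_left ?_ _))
  exact (finrank_range_le_card _).trans (by rw [Fintype.card_fin])

theorem finrank_lowDegree_le_sum {J : Ideal (MvPolynomial (Fin n) ℚ)}
    (hJ : ∀ f ∈ J, ∀ d, evalAt w (homogeneousComponent d f) ∈ lowDegree w d) (D : ℕ) :
    Module.finrank ℚ (lowDegree w D) ≤
      ∑ d ∈ Finset.range D, Module.finrank ℚ (quotComp n J d) := by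
  induction D with
  | zero => simp [lowDegree_zero]
  | succ D ih =>
    rw [Finset.sum_range_succ]
    exact (finrank_lowDegree_succ_le hJ D).trans (Nat.add_le_add_right ih _)

/-- Every function on a finite set of distinct points is given by a polynomial. -/
theorem exists_lowDegree_eq_top (hw : Function.Injective w) :
    ∃ D, ∀ D', D ≤ D' → lowDegree w D' = ⊤ := by
  classical
  have := Fintype.ofFinite ι
  have hsep : ∀ x y : ι, ∃ p : MvPolynomial (Fin n) ℚ,
      x ≠ y → evalAt w p x = 1 ∧ evalAt w p y = 0 := by
    intro x y
    by_cases hxy : x = y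
    · exact ⟨0, fun h => absurd hxy h⟩
    · obtain ⟨i, hi⟩ := Function.ne_iff.1 fun h => hxy (hw h)
      have hne : (w x i : ℚ) - w y i ≠ 0 := sub_ne_zero.2 (Nat.cast_injective.ne hi)
      refine ⟨C ((w x i : ℚ) - w y i)⁻¹ * (X i - C (w y i : ℚ)), fun _ => ?_⟩
      simp only [evalAt_apply]
      simp [hne]
  choose p hp using hsep
  let q : ι → MvPolynomial (Fin n) ℚ := fun x => ∏ y ∈ Finset.univ.erase x, p x y
  have hq : ∀ x, evalAt w (q x) = Pi.single x 1 := by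
    intro x
    ext y
    simp only [q, map_prod, Finset.prod_apply]
    by_cases hxy : y = x
    · subst hxy
      rw [Pi.single_eq_same]
      exact Finset.prod_eq_one fun z hz => (hp y z (Finset.ne_of_mem_erase hz).symm).1
    · rw [Pi.single_eq_of_ne hxy]
      exact Finset.prod_eq_zero (Finset.mem_erase.2 ⟨hxy, Finset.mem_univ y⟩)
        (hp x y (Ne.symm hxy)).2
  refine ⟨Finset.univ.sup (fun x => (q x).totalDegree) + 1, fun D hD => ?_⟩
  refine Submodule.eq_top_iff'.2 fun f => ?_
  rw [← Finset.univ_sum_single f]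
  refine sum_mem fun x _ => ?_
  have h1 : (Pi.single x (f x) : ι → ℚ) = f x • evalAt w (q x) := by
    rw [hq, ← Pi.single_smul, smul_eq_mul, mul_one]
  rw [h1]
  refine Submodule.smul_mem _ _ (evalAt_mem_lowDegree fun m hm => ?_)
  have h2 : m.degree ≤ (q x).totalDegree := le_totalDegree hm
  have h3 := Finset.le_sup (f := fun x => (q x).totalDegree) (Finset.mem_univ x)
  exact Nat.lt_of_le_of_lt h2 (Nat.lt_of_lt_of_le (Nat.lt_succ_of_le h3) hD)

end Evaluation

theorem sum_finrank_quotCompShift_le {n : ℕ} (I : Ideal (MvPolynomial (Fin n) ℚ)) (c D : ℕ) :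
    ∑ d ∈ Finset.range D, Module.finrank ℚ (quotCompShift n I d c) ≤
      ∑ d ∈ Finset.range D, Module.finrank ℚ (quotComp n I d) := by
  calc ∑ d ∈ Finset.range D, Module.finrank ℚ (quotCompShift n I d c)
      ≤ ∑ d ∈ Finset.range (c + D), Module.finrank ℚ (quotCompShift n I d c) :=
        Finset.sum_le_sum_of_subset (Finset.range_mono (Nat.le_add_left D c))
    _ = ∑ d ∈ Finset.range D, Module.finrank ℚ (quotComp n I d) := by
        rw [Finset.sum_range_add, Finset.sum_eq_zero, zero_add]
        · refine Finset.sum_congr rfl fun d _ => ?_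
          rw [show quotCompShift n I (c + d) c = quotComp n I (c + d - c) from
            if_pos (Nat.le_add_right c d), Nat.add_sub_cancel_left]
        · intro d hd
          rw [show quotCompShift n I d c = ⊥ from if_neg (not_le.2 (Finset.mem_range.1 hd)),
            finrank_bot]

/-- Packed words of length `n` in the letters `0, 1, …` using at least `k` letters, grouped by
the number of letters. -/
abbrev PackedWord (n k : ℕ) : Type :=
  Σ j : Finset.Icc k n, {f : Fin n → Fin j // ∀ a ∈ Finset.univ, ∃ i, f i = a}

/-- The word underlying a packed word. -/
def PackedWord.letter {n k : ℕ} (x : PackedWord n k) (i : Fin n) : ℕ :=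
  x.2.1 i

theorem PackedWord.exists_letter_eq {n k : ℕ} (x : PackedWord n k) {a : ℕ} (ha : a < x.1) :
    ∃ i, x.letter i = a := by
  obtain ⟨i, hi⟩ := x.2.2 ⟨a, ha⟩ (Finset.mem_univ _)
  exact ⟨i, congrArg Fin.val hi⟩

theorem PackedWord.letter_injective {n k : ℕ} :
    Function.Injective (PackedWord.letter (n := n) (k := k)) := by
  have hle : ∀ x y : PackedWord n k, x.letter = y.letter → (x.1 : ℕ) ≤ y.1 := by
    intro x y h
    by_contra hlt
    obtain ⟨i, hi⟩ := x.exists_letter_eq (not_le.1 hlt)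
    have : y.letter i < y.1 := (y.2.1 i).2
    rw [h] at hi
    omega
  intro x y h
  have hj : x.1 = y.1 := Subtype.ext (le_antisymm (hle x y h) (hle y x h.symm))
  obtain ⟨j, f⟩ := x
  obtain ⟨j', g⟩ := y
  obtain rfl : j = j' := hj
  congr 1
  exact Subtype.ext (funext fun i => Fin.ext (congrFun h i))

theorem card_packedWord (n k : ℕ) :
    Fintype.card (PackedWord n k) = ∑ j ∈ Finset.Icc k n, wordCount j n j := by
  rw [Fintype.card_sigma, ← Finset.sum_coe_sort (Finset.Icc k n) fun j => wordCount j n j]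
  refine Finset.sum_congr rfl fun j _ => ?_
  rw [card_words, Finset.card_univ, Fintype.card_fin]

theorem eq_of_sum_range_le {A B : ℕ → ℕ} (hAB : ∀ e, A e ≤ B e) {D : ℕ}
    (h : ∑ e ∈ Finset.range D, B e ≤ ∑ e ∈ Finset.range D, A e) {d : ℕ} (hd : d < D) :
    A d = B d :=
  (Finset.sum_eq_sum_iff_of_le fun e _ => hAB e).1
    (le_antisymm (Finset.sum_le_sum fun e _ => hAB e) h) d (Finset.mem_range.2 hd)

/-- The dimension of `ℚ[x_1, …, x_n]/J_{n,k}` is at least the number of packed words. -/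
theorem sum_wordCount_le_sum_finrank (n k : ℕ) :
    ∃ D₀, ∀ D, D₀ ≤ D → ∑ j ∈ Finset.Icc k n, wordCount j n j ≤
      ∑ e ∈ Finset.range D, Module.finrank ℚ (quotComp n (packedIdeal n k) e) := by
  obtain ⟨D₀, hD₀⟩ := exists_lowDegree_eq_top (PackedWord.letter_injective (n := n) (k := k))
  refine ⟨D₀, fun D hD => ?_⟩
  have h := finrank_lowDegree_le_sum (w := PackedWord.letter (n := n) (k := k))
    (J := packedIdeal n k) (fun f hf e => evalAt_mem_lowDegree_of_mem_packedIdeal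
      (fun x p a ha => x.exists_letter_eq (lt_trans ha (x.2.1 p).2))
      (fun x a ha => x.exists_letter_eq (lt_of_lt_of_le ha (Finset.mem_Icc.1 x.1.2).1)) hf e) D
  rwa [hD₀ D hD, finrank_top, Module.finrank_fintype_fun_eq_card, card_packedWord] at h

/-- for `1 ≤ k ≤ n` and every degree `d`,
`dim_ℚ (S_{n,k})_d = Σ_{j=k}^n dim_ℚ (R_{n,j})_{d-(n-j)}` (components in negative degree
being zero); equivalently `Hilb(S_{n,k}; q) = Σ_{j=k}^n q^{n-j} · Hilb(R_{n,j}; q)`. -/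
theorem hilbert_series (n k : ℕ) (hk : 1 ≤ k) (hkn : k ≤ n) (d : ℕ) :
    Module.finrank ℚ ↥(quotComp n (Jnk n k) d) =
      ∑ j ∈ Finset.Icc k n,
        Module.finrank ℚ ↥(quotCompShift n (Ink n j) d (n - j)) := by
  rw [show Jnk n k = packedIdeal n k from Jnk_eq hkn]
  obtain ⟨D₀, hD₀⟩ := sum_wordCount_le_sum_finrank n k
  refine eq_of_sum_range_le (A := fun e => Module.finrank ℚ (quotComp n (packedIdeal n k) e))
    (B := fun e => ∑ j ∈ Finset.Icc k n, Module.finrank ℚ (quotCompShift n (Ink n j) e (n - j)))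
    (fun e => finrank_quotComp_packedIdeal_le hk (by omega) e) (D := max D₀ (d + 1)) ?_
    (lt_of_lt_of_le (Nat.lt_succ_self d) (le_max_right _ _))
  refine le_trans ?_ (hD₀ _ (le_max_left _ _))
  rw [Finset.sum_comm]
  exact Finset.sum_le_sum fun j hj => (sum_finrank_quotCompShift_le _ _ _).trans
    (sum_finrank_quotComp_Ink_le (Finset.mem_Icc.1 hj).2 _)

end PackedWords
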